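/- arXiv:0710.5263 — 2 statements merged into one kernel-verified Lean document; each statement's English description precedes it below -/
import Mathlib

section
/- Let G be a finite group, g ≥ 1 an integer, and w ∈ G. Then f_g(w) = Σ_{λ ∈ Ĝ} (|G| / dim λ)^{2g−1} · χ_λ(w), as an equality of complex numbers, where f_g(w) is the number of 2g-tuples (s₁,t₁,…,s_g,t_g) ∈ G^{2g} with [s₁,t₁]⋯[s_g,t_g] = w. -/
open CategoryTheory

section Aux

variable {G : Type} [Group G] [Fintype G]

theorem aux_schur (V : FDRep ℂ G) [Simple V] (T : V →ₗ[ℂ] V)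
    (hT : ∀ g : G, T ∘ₗ V.ρ g = V.ρ g ∘ₗ T) : ∃ c : ℂ, T = c • LinearMap.id := by
  have h1 := finrank_endomorphism_simple_eq_one ℂ V
  let f : V ⟶ V := ⟨InducedCategory.homMk (ModuleCat.ofHom T), fun g => by
    ext1
    ext x
    exact LinearMap.congr_fun (hT g) x⟩
  obtain ⟨c, hc⟩ := (finrank_eq_one_iff_of_nonzero' (𝟙 V) (id_nonzero V)).mp h1 f
  refine ⟨c, ?_⟩
  have h2 : ((c • 𝟙 V : V ⟶ V).hom.hom).hom = f.hom.hom.hom := by rw [hc]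
  exact h2.symm

theorem aux_norm (V : FDRep ℂ G) [hV : Simple V] :
    ∑ g : G, V.character g * V.character g⁻¹ = Fintype.card G := by
  rw [(FDRep.simple_iff_char_is_norm_one V).mp hV, Nat.card_eq_fintype_card]

theorem aux_orth (V W : FDRep ℂ G) [Simple V] [Simple W] (h : ¬ Nonempty (V ≅ W)) :
    ∑ g : G, V.character g * W.character g⁻¹ = 0 := by
  have : Invertible (Nat.card G : ℂ) := invertibleOfNonzero (NeZero.ne _)
  have h1 := FDRep.char_orthonormal V W
  rw [if_neg h] at h1
  have h2 : (Nat.card G : ℂ) ≠ 0 := NeZero.ne _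
  simpa using (mul_eq_zero.mp h1).resolve_left (inv_ne_zero h2)

theorem aux_dim (V : FDRep ℂ G) [Simple V] : V.character 1 ≠ 0 := by
  intro h
  rw [FDRep.char_one, Nat.cast_eq_zero] at h
  have hs : Subsingleton V := Module.finrank_zero_iff.mp h
  have h1 := aux_norm V
  have h2 : ∀ g, V.character g = 0 := fun g => by
    have : V.ρ g = 0 := by ext x; exact Subsingleton.elim _ _
    simp [FDRep.character, this]
  simp only [h2, mul_zero, Finset.sum_const_zero] at h1
  exact Nat.cast_ne_zero.mpr Fintype.card_ne_zero h1.symm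

theorem aux_scalar (V : FDRep ℂ G) [Simple V] (T : V →ₗ[ℂ] V)
    (hT : ∀ g : G, T ∘ₗ V.ρ g = V.ρ g ∘ₗ T) :
    T = (LinearMap.trace ℂ V T / V.character 1) • LinearMap.id := by
  obtain ⟨c, hc⟩ := aux_schur V T hT
  have h1 : LinearMap.trace ℂ V T = c * V.character 1 := by
    rw [hc, map_smul, LinearMap.trace_id, FDRep.char_one, smul_eq_mul]
  rw [h1, mul_div_cancel_right₀ _ (aux_dim V)]
  exact hc

/-- class-function weighted sums are scalar -/
theorem aux_classfun (V : FDRep ℂ G) [Simple V] (φ : G → ℂ)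
    (hφ : ∀ g h : G, φ (h * g * h⁻¹) = φ g) :
    ∑ g : G, φ g • V.ρ g = ((∑ g : G, φ g * V.character g) / V.character 1) • LinearMap.id := by
  have h := aux_scalar V (∑ g : G, φ g • V.ρ g) (fun h => by
    change (∑ g : G, φ g • V.ρ g) * V.ρ h = V.ρ h * (∑ g : G, φ g • V.ρ g)
    rw [Finset.sum_mul, Finset.mul_sum]
    rw [← Equiv.sum_comp (MulAut.conj h).toEquiv]
    refine Finset.sum_congr rfl fun g _ => ?_
    have h1 : φ (h * g * h⁻¹) = φ g := hφ g h
    simp only [MulEquiv.toEquiv_eq_coe, EquivLike.coe_coe, MulAut.conj_apply, h1]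
    rw [smul_mul_assoc, mul_smul_comm, ← map_mul, ← map_mul]
    congr 2
    group)
  rw [h]
  simp [FDRep.character]

theorem aux_conj (V : FDRep ℂ G) [Simple V] (t : G) :
    ∑ s : G, V.ρ (s * t * s⁻¹) =
      ((Fintype.card G : ℂ) * V.character t / V.character 1) • LinearMap.id := by
  have h := aux_scalar V (∑ s : G, V.ρ (s * t * s⁻¹)) (fun h => by
    change (∑ g : G, V.ρ _) * V.ρ h = V.ρ h * (∑ g : G, V.ρ _)
    rw [Finset.sum_mul, Finset.mul_sum]
    rw [← Equiv.sum_comp (Equiv.mulLeft h)]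
    refine Finset.sum_congr rfl fun g _ => ?_
    rw [← map_mul, ← map_mul]
    congr 1
    simp [mul_assoc])
  rw [h, map_sum]
  congr 2
  have : ∀ s, LinearMap.trace ℂ V (V.ρ (s * t * s⁻¹)) = V.character t := fun s =>
    FDRep.char_conj V t s
  simp only [this, Finset.sum_const, Finset.card_univ, nsmul_eq_mul]

theorem aux_comm (V : FDRep ℂ G) [Simple V] :
    ∑ p : G × G, V.ρ (p.1 * p.2 * p.1⁻¹ * p.2⁻¹)⁻¹ =
      (((Fintype.card G : ℂ) / V.character 1) ^ 2) • LinearMap.id := by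
  have h0 : ∀ p : G × G, V.ρ (p.1 * p.2 * p.1⁻¹ * p.2⁻¹)⁻¹ =
      V.ρ p.2 * V.ρ (p.1 * p.2⁻¹ * p.1⁻¹) := fun p => by
    rw [← map_mul]; congr 1; group
  simp only [h0]
  rw [Fintype.sum_prod_type_right]
  simp only [← Finset.mul_sum, aux_conj]
  have h1 : ∀ t : G, V.ρ t * (((Fintype.card G : ℂ) * V.character t⁻¹ / V.character 1) •
      (LinearMap.id : V →ₗ[ℂ] V)) =
      ((Fintype.card G : ℂ) / V.character 1) • (V.character t⁻¹ • V.ρ t) := fun t => by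
    rw [mul_smul_comm, smul_smul, div_mul_eq_mul_div]
    rfl
  simp only [h1]
  rw [← Finset.smul_sum, aux_classfun V (fun t => V.character t⁻¹)
    (fun g h => by
      have := FDRep.char_conj V g⁻¹ h
      rwa [show h * g⁻¹ * h⁻¹ = (h * g * h⁻¹)⁻¹ by group] at this)]
  have h2 : ∑ t : G, V.character t⁻¹ * V.character t = Fintype.card G := by
    rw [← aux_norm V]
    exact Finset.sum_congr rfl fun _ _ => mul_comm _ _
  rw [h2, smul_smul, sq]

theorem aux_prod (V : FDRep ℂ G) [Simple V] (g : ℕ) :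
    ∑ x : Fin g → G × G, V.ρ
      (List.ofFn fun i => (x i).1 * (x i).2 * ((x i).1)⁻¹ * ((x i).2)⁻¹).prod⁻¹ =
      (((Fintype.card G : ℂ) / V.character 1) ^ (2 * g)) • LinearMap.id := by
  induction g with
  | zero => simp; rfl
  | succ g ih =>
    rw [← Equiv.sum_comp (Fin.consEquiv fun _ => G × G), Fintype.sum_prod_type_right]
    simp only [Fin.consEquiv_apply, List.ofFn_succ, Fin.cons_zero, Fin.cons_succ, List.prod_cons,
      mul_inv_rev (_ * _ * _ * _), map_mul V.ρ (List.prod _)⁻¹]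
    simp only [← Finset.mul_sum, aux_comm]
    rw [← Finset.sum_mul, ih, mul_add, pow_add, smul_mul_smul_comm]
    rfl

theorem aux_simple_of_irr {W : Type} [AddCommGroup W] [Module ℂ W] [Module.Finite ℂ W]
    (σ : Representation ℂ G W) [σ.IsIrreducible] : Simple (FDRep.of σ) := by
  rw [FDRep.simple_iff_char_is_norm_one]
  have : Invertible (Nat.card G : ℂ) := invertibleOfNonzero (NeZero.ne _)
  have h := Representation.char_orthonormal σ σ
  rw [if_pos ⟨Representation.Equiv.refl σ⟩] at h
  have h2 : (Nat.card G : ℂ) ≠ 0 := NeZero.ne _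
  rw [inv_mul_eq_iff_eq_mul₀ h2] at h
  rw [mul_one] at h
  exact h

theorem aux_module (ψ : G → ℂ) (c : ℂ)
    (hz : ∀ V : FDRep ℂ G, Simple V → ∑ g : G, ψ g • V.ρ g = c • LinearMap.id)
    (M : Type) [AddCommGroup M] [Module ℂ M] [Module (MonoidAlgebra ℂ G) M]
    [IsScalarTower ℂ (MonoidAlgebra ℂ G) M]
    [hm : IsSimpleModule (MonoidAlgebra ℂ G) M] (x : M) :
    (∑ g : G, MonoidAlgebra.single g (ψ g) : MonoidAlgebra ℂ G) • x = c • x := by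
  let σ : Representation ℂ G M := Representation.ofModule' (k := ℂ) (G := G) M
  have hσ : ∀ (r : MonoidAlgebra ℂ G) (y : M), σ.asAlgebraHom r y = r • y := fun r y => by
    have : σ.asAlgebraHom = Algebra.lsmul ℂ ℂ M :=
      (MonoidAlgebra.lift ℂ (M →ₗ[ℂ] M) G).apply_symm_apply _
    rw [this]
    rfl
  let e : σ.asModule ≃ₗ[MonoidAlgebra ℂ G] M :=
    { σ.asModuleEquiv.toAddEquiv with
      map_smul' := fun r y => hσ r y }
  have hsm : IsSimpleModule (MonoidAlgebra ℂ G) σ.asModule := IsSimpleModule.congr e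
  have hirr : σ.IsIrreducible := (Representation.irreducible_iff_isSimpleModule_asModule σ).mpr hsm
  have hfin : Module.Finite ℂ M := Module.Finite.trans (MonoidAlgebra ℂ G) _
  have hs := aux_simple_of_irr σ
  have h1 : ∑ g : G, ψ g • σ g = c • LinearMap.id := hz _ hs
  have h2 : σ.asAlgebraHom (∑ g : G, MonoidAlgebra.single g (ψ g)) = c • LinearMap.id := by
    rw [← h1]
    simp only [map_sum, Representation.asAlgebraHom_single]
  rw [← hσ, h2]
  rfl

open scoped Classical in
theorem aux_regular {ι : Type} [Fintype ι] (Irr : ι → FDRep ℂ G)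
    (hsimple : ∀ i, Simple (Irr i))
    (hirredundant : ∀ i j : ι, Nonempty (Irr i ≅ Irr j) → i = j)
    (hcomplete : ∀ V : FDRep ℂ G, Simple V → ∃ i, Nonempty (V ≅ Irr i)) (g : G) :
    ∑ i, (Irr i).character 1 * (Irr i).character g⁻¹ =
      if g = 1 then (Fintype.card G : ℂ) else 0 := by
  classical
  let ψ : G → ℂ := fun g => ∑ i, (Irr i).character 1 * (Irr i).character g⁻¹
  let z : MonoidAlgebra ℂ G := ∑ g : G, MonoidAlgebra.single g (ψ g)
  have hcard : (Fintype.card G : ℂ) ≠ 0 := by simp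
  have hψ : ∀ g h : G, ψ (h * g * h⁻¹) = ψ g := fun g h => by
    refine Finset.sum_congr rfl fun i _ => ?_
    have := FDRep.char_conj (Irr i) g⁻¹ h
    rw [show h * g⁻¹ * h⁻¹ = (h * g * h⁻¹)⁻¹ by group] at this
    rw [this]
  -- z acts as |G| on every simple
  have hz : ∀ V : FDRep ℂ G, Simple V →
      ∑ g : G, ψ g • V.ρ g = (Fintype.card G : ℂ) • LinearMap.id := fun V hV => by
    rw [aux_classfun V ψ hψ]
    congr 1
    obtain ⟨j, ⟨e⟩⟩ := hcomplete V hV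
    rw [div_eq_iff (aux_dim V), FDRep.char_iso e]
    simp only [ψ, Finset.sum_mul]
    rw [Finset.sum_comm, Finset.sum_eq_single j]
    · have := aux_norm (Irr j)
      rw [← this, Finset.sum_mul]
      exact Finset.sum_congr rfl fun _ _ => by ring
    · intro i _ hij
      have := aux_orth (Irr j) (Irr i) (fun h => hij (hirredundant _ _ h).symm)
      rw [← mul_zero ((Irr i).character 1), ← this, Finset.mul_sum]
      exact Finset.sum_congr rfl fun _ _ => by ring
    · simp
  have hmod : ∀ m : Submodule (MonoidAlgebra ℂ G) (MonoidAlgebra ℂ G),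
      IsSimpleModule (MonoidAlgebra ℂ G) m → ∀ x ∈ m, z * x = (Fintype.card G : ℂ) • x := by
    intro m hm x hx
    have h := aux_module ψ _ hz m ⟨x, hx⟩
    have h4 := congrArg Subtype.val h
    exact h4
  have hall : ∀ x : MonoidAlgebra ℂ G, z * x = (Fintype.card G : ℂ) • x := by
    intro x
    have hx : x ∈ sSup { m : Submodule (MonoidAlgebra ℂ G) (MonoidAlgebra ℂ G) |
        IsSimpleModule (MonoidAlgebra ℂ G) m } := by
      rw [IsSemisimpleModule.sSup_simples_eq_top]; trivial
    rw [sSup_eq_iSup'] at hx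
    refine Submodule.iSup_induction _ (motive := fun x => z * x = (Fintype.card G : ℂ) • x) hx
      (fun m y hy => hmod m.1 m.2 y hy) (by simp) (fun y y' h h' => ?_)
    rw [mul_add, h, h', smul_add]
  have h1 := hall 1
  rw [mul_one] at h1
  have h2 : z.coeff g = ((Fintype.card G : ℂ) • (1 : MonoidAlgebra ℂ G)).coeff g := by rw [h1]
  have h3 : z.coeff g = ψ g := by
    simp [z, Finsupp.single_apply]
  rw [h3] at h2
  change ψ g = _
  rw [h2, MonoidAlgebra.one_def]
  simp [Finsupp.single_apply, eq_comm]

end Aux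


/-- **Counting formula for the twisted case.** For a finite group `G`, `g ≥ 1` and `w ∈ G`,
the number `f_g(w)` of `2g`-tuples `(s₁,t₁,…,s_g,t_g) ∈ G^{2g}` with
`[s₁,t₁]⋯[s_g,t_g] = w` satisfies `f_g(w) = Σ_{λ ∈ Ĝ} (|G|/dim λ)^{2g-1} · χ_λ(w)`
as complex numbers.  Here `Ĝ` is encoded by a complete irredundant family
`Irr : ι → FDRep ℂ G` of irreducible complex representations of `G`, and
`dim λ = χ_λ(1)`. -/
theorem counting_formula_twisted
    (G : Type) [Group G] [Fintype G]
    (ι : Type) [Fintype ι] (Irr : ι → FDRep ℂ G)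
    (hsimple : ∀ i, Simple (Irr i))
    (hirredundant : ∀ i j : ι, Nonempty (Irr i ≅ Irr j) → i = j)
    (hcomplete : ∀ V : FDRep ℂ G, Simple V → ∃ i, Nonempty (V ≅ Irr i))
    (g : ℕ) (hg : 1 ≤ g) (w : G) :
    ((Nat.card {x : Fin g → G × G //
        (List.ofFn fun i => (x i).1 * (x i).2 * ((x i).1)⁻¹ * ((x i).2)⁻¹).prod = w} : ℕ) : ℂ)
      = ∑ i : ι, ((Fintype.card G : ℂ) / (Irr i).character 1) ^ (2 * g - 1)
          * (Irr i).character w := by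
  classical
  have hcard : (Fintype.card G : ℂ) ≠ 0 := Nat.cast_ne_zero.mpr Fintype.card_ne_zero
  let P : (Fin g → G × G) → G := fun x =>
    (List.ofFn fun i => (x i).1 * (x i).2 * ((x i).1)⁻¹ * ((x i).2)⁻¹).prod
  have hL : ((Nat.card {x : Fin g → G × G // P x = w} : ℕ) : ℂ) * Fintype.card G =
      ∑ x, if P x = w then (Fintype.card G : ℂ) else 0 := by
    rw [Nat.card_eq_fintype_card, Fintype.card_subtype, ← Finset.sum_filter, Finset.sum_const,
      nsmul_eq_mul]
  have hx : ∀ x, (if P x = w then (Fintype.card G : ℂ) else 0) =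
      ∑ i, (Irr i).character 1 * (Irr i).character ((P x)⁻¹ * w) := fun x => by
    have h := aux_regular Irr hsimple hirredundant hcomplete (w⁻¹ * P x)
    rw [mul_inv_rev, inv_inv] at h
    rw [h]
    refine if_congr ?_ rfl rfl
    rw [inv_mul_eq_one, eq_comm]
  have hi : ∀ i, ∑ x, (Irr i).character ((P x)⁻¹ * w) =
      ((Fintype.card G : ℂ) / (Irr i).character 1) ^ (2 * g) * (Irr i).character w := fun i => by
    have h := congrArg (fun T => LinearMap.trace ℂ (Irr i) (T * (Irr i).ρ w)) (aux_prod (Irr i) g)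
    have h2 : ∀ T : (Irr i) →ₗ[ℂ] (Irr i), LinearMap.id * T = T := fun T => rfl
    simp only [Finset.sum_mul, map_sum, ← map_mul, smul_mul_assoc, map_smul, h2, smul_eq_mul] at h
    exact h
  refine mul_right_cancel₀ hcard (hL.trans ?_)
  simp only [hx]
  rw [Finset.sum_comm, Finset.sum_mul]
  refine Finset.sum_congr rfl fun i _ => ?_
  rw [← Finset.mul_sum, hi]
  have hd := aux_dim (Irr i)
  obtain ⟨n, rfl⟩ : ∃ n, g = n + 1 := ⟨g - 1, by omega⟩
  rw [show 2 * (n + 1) - 1 = 2 * n + 1 by omega, show 2 * (n + 1) = (2 * n + 1) + 1 by ring,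
    pow_succ _ (2 * n + 1)]
  field_simp
end

section
/- (Frobenius's formula) Let G be a finite group and w ∈ G. Then the number of pairs (s,t) ∈ G × G with s t s⁻¹ t⁻¹ = w equals, as a complex number, Σ_{λ ∈ Ĝ} (|G| / dim λ) · χ_λ(w). -/
open CategoryTheory

lemma frob_schur {G : Type} [Group G] [Fintype G] (V : FDRep ℂ G) [Simple V]
    (A : V →ₗ[ℂ] V) (h : ∀ g, A ∘ₗ V.ρ g = V.ρ g ∘ₗ A) : ∃ c : ℂ, A = c • LinearMap.id := by
  have h1 : Module.finrank ℂ (V ⟶ V) = 1 := finrank_endomorphism_simple_eq_one ℂ V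
  rw [← LinearEquiv.finrank_eq (Representation.linHom.invariantsEquivFDRepHom V V)] at h1
  obtain ⟨⟨B, hB⟩, hB0, hB1⟩ := finrank_eq_one_iff'.mp h1
  have key : ∀ A : V →ₗ[ℂ] V, (∀ g, A ∘ₗ V.ρ g = V.ρ g ∘ₗ A) → ∃ c : ℂ, c • B = A := by
    intro A h
    have hA : A ∈ (Representation.linHom V.ρ V.ρ).invariants := by
      intro g
      rw [Representation.linHom_apply, ← LinearMap.comp_assoc, ← h, LinearMap.comp_assoc,
        ← Module.End.mul_eq_comp (V.ρ g), ← map_mul]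
      simp [Module.End.one_eq_id]
    obtain ⟨c, hc⟩ := hB1 ⟨A, hA⟩
    exact ⟨c, congrArg Subtype.val hc⟩
  obtain ⟨a, ha⟩ := key A h
  obtain ⟨b, hb⟩ := key LinearMap.id (fun g => rfl)
  by_cases hb0 : b = 0
  · subst hb0
    refine ⟨0, LinearMap.ext fun x => ?_⟩
    have : x = 0 := by simpa using (LinearMap.congr_fun hb x).symm
    subst this; simp
  · refine ⟨a * b⁻¹, ?_⟩
    rw [← hb, smul_smul, mul_assoc, inv_mul_cancel₀ hb0, mul_one, ha]

lemma frob_schur_trace {G : Type} [Group G] [Fintype G] (V : FDRep ℂ G) [Simple V]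
    (A : V →ₗ[ℂ] V) (h : ∀ g, A ∘ₗ V.ρ g = V.ρ g ∘ₗ A) :
    V.character 1 • A = LinearMap.trace ℂ V A • LinearMap.id := by
  obtain ⟨c, rfl⟩ := frob_schur V A h
  rw [map_smul, FDRep.char_one, smul_smul, LinearMap.trace_id, smul_eq_mul, mul_comm]

lemma frob_norm {G : Type} [Group G] [Fintype G] (V : FDRep ℂ G) [Simple V] :
    ∑ g : G, V.character g * V.character g⁻¹ = Fintype.card G := by
  have := (FDRep.simple_iff_char_is_norm_one V).1 inferInstance
  rw [this, Nat.card_eq_fintype_card]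

lemma frob_dim_ne {G : Type} [Group G] [Fintype G] (V : FDRep ℂ G) [Simple V] :
    V.character 1 ≠ 0 := by
  intro h
  rw [FDRep.char_one] at h
  have h0 : Module.finrank ℂ V = 0 := by exact_mod_cast h
  have hs := Module.finrank_zero_iff.1 h0
  have : ∀ g, V.character g = 0 := fun g => by
    have : V.ρ g = 0 := Subsingleton.elim _ _
    simp [FDRep.character, this]
  have h2 := frob_norm V
  simp only [this, mul_zero, Finset.sum_const_zero] at h2
  exact Fintype.card_ne_zero (α := G) (by exact_mod_cast h2.symm)

/-- class function combos commute -/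
lemma frob_class {G : Type} [Group G] [Fintype G] (V : FDRep ℂ G) [Simple V] (f : G → ℂ)
    (hf : ∀ g h, f (h * g * h⁻¹) = f g) :
    V.character 1 • (∑ g, f g • V.ρ g⁻¹) = (∑ g, f g * V.character g⁻¹) • LinearMap.id := by
  rw [frob_schur_trace]
  · simp [FDRep.character]
  · intro h
    change (∑ g, f g • V.ρ g⁻¹) * V.ρ h = V.ρ h * (∑ g, f g • V.ρ g⁻¹)
    rw [Finset.sum_mul, Finset.mul_sum]
    refine Fintype.sum_equiv (MulAut.conj h⁻¹).toEquiv _ _ fun g => ?_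
    simp only [MulEquiv.toEquiv_eq_coe, MulEquiv.coe_toEquiv, MulAut.conj_apply, hf, smul_mul_assoc,
      mul_smul_comm, ← map_mul]
    congr 2
    group

lemma frob_conj {G : Type} [Group G] [Fintype G] (V : FDRep ℂ G) [Simple V] (t : G) :
    V.character 1 • (∑ s, V.ρ (s * t * s⁻¹)) =
      ((Fintype.card G : ℂ) * V.character t) • LinearMap.id := by
  rw [frob_schur_trace]
  · congr 1
    rw [map_sum]
    change ∑ s, V.character (s * t * s⁻¹) = _
    simp
  · intro h
    change (∑ s, V.ρ (s * t * s⁻¹)) * V.ρ h = V.ρ h * (∑ s, V.ρ (s * t * s⁻¹))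
    rw [Finset.sum_mul, Finset.mul_sum]
    refine Fintype.sum_equiv (Equiv.mulLeft h⁻¹) _ _ fun g => ?_
    simp [← map_mul, mul_assoc]

lemma frob_sum {G : Type} [Group G] [Fintype G] (V : FDRep ℂ G) [Simple V] (w : G) :
    V.character 1 * ∑ s, ∑ t, V.character (s * t * s⁻¹ * t⁻¹ * w) =
      (Fintype.card G : ℂ) ^ 2 / V.character 1 * V.character w := by
  have hd := frob_dim_ne V
  rw [Finset.sum_comm, Finset.mul_sum]
  have h1 : ∀ t, V.character 1 * ∑ s, V.character (s * t * s⁻¹ * t⁻¹ * w) =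
      Fintype.card G * V.character t * V.character (t⁻¹ * w) := by
    intro t
    have := congrArg (fun A => LinearMap.trace ℂ V (A * V.ρ (t⁻¹ * w))) (frob_conj V t)
    simp only [smul_mul_assoc, map_smul, Finset.sum_mul, map_sum, ← map_mul, smul_eq_mul] at this
    simp only [← mul_assoc (_ * t * _) t⁻¹ w] at this
    exact this
  simp_rw [h1, mul_assoc]
  rw [← Finset.mul_sum]
  have h2 := congrArg (fun A => LinearMap.trace ℂ V (A * V.ρ w))
    (frob_class V V.character (fun g h => V.char_conj g h))
  simp only [smul_mul_assoc, map_smul, Finset.sum_mul, map_sum, ← map_mul, smul_eq_mul,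
    frob_norm] at h2
  have h3 : V.character 1 * ∑ t, V.character t * V.character (t⁻¹ * w) =
    Fintype.card G * V.character w := h2
  field_simp
  linear_combination h3

lemma frob_kill {G : Type} [Group G] [Fintype G] (f : G → ℂ)
    (hf : ∀ V : FDRep ℂ G, Simple V → ∑ g, f g • V.ρ g⁻¹ = 0)
    (M : Type) [AddCommGroup M] [Module ℂ M] [Module (MonoidAlgebra ℂ G) M]
    [IsScalarTower ℂ (MonoidAlgebra ℂ G) M]
    [hM : IsSimpleModule (MonoidAlgebra ℂ G) M] (x : M) :
    (∑ g, MonoidAlgebra.single g⁻¹ (f g) : MonoidAlgebra ℂ G) • x = 0 := by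
  have : Module.Finite ℂ M := Module.Finite.trans (MonoidAlgebra ℂ G) _
  set ρ : Representation ℂ G M := Representation.ofModule' (k := ℂ) (G := G) M with hρ
  have hact : ∀ (r : MonoidAlgebra ℂ G) (y : M), ρ.asAlgebraHom r y = r • y := by
    intro r y
    simp [hρ, Representation.asAlgebraHom, Representation.ofModule']
  have hirr : ρ.IsIrreducible := by
    rw [Representation.irreducible_iff_isSimpleModule_asModule]
    let e : ρ.asModule ≃ₗ[MonoidAlgebra ℂ G] M :=
      { ρ.asModuleEquiv.toAddEquiv with
        map_smul' := fun r y => by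
          have := ρ.asModuleEquiv_map_smul r y
          rw [hact] at this
          exact this }
    exact IsSimpleModule.congr e
  have hsimp : Simple (FDRep.of ρ) := by
    rw [FDRep.simple_iff_char_is_norm_one]
    have := invertibleOfNonzero (NeZero.ne (Nat.card G : ℂ))
    have h := Representation.char_orthonormal ρ ρ
    rw [if_pos ⟨Representation.Equiv.refl ρ⟩, inv_mul_eq_one₀ (NeZero.ne _)] at h
    exact h.symm
  have h1 : ∑ g, f g • ρ g⁻¹ = 0 := hf _ hsimp
  have h2 : ρ.asAlgebraHom (∑ g, MonoidAlgebra.single g⁻¹ (f g)) = 0 := by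
    rw [map_sum, ← h1]
    simp only [Representation.asAlgebraHom_single]
  rw [← hact, h2, LinearMap.zero_apply]

lemma frob_zero {G : Type} [Group G] [Fintype G] (f : G → ℂ)
    (hf : ∀ V : FDRep ℂ G, Simple V → ∑ g, f g • V.ρ g⁻¹ = 0) : f = 0 := by
  classical
  set z : MonoidAlgebra ℂ G := ∑ g, MonoidAlgebra.single g⁻¹ (f g) with hz
  have key : ∀ S : Submodule (MonoidAlgebra ℂ G) (MonoidAlgebra ℂ G),
      IsSimpleModule (MonoidAlgebra ℂ G) S → ∀ x ∈ S, z * x = 0 := by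
    intro S hS x hx
    exact congrArg Subtype.val (frob_kill f hf S ⟨x, hx⟩)
  have hz0 : z * 1 = 0 := by
    have : (1 : MonoidAlgebra ℂ G) ∈ sSup {S : Submodule (MonoidAlgebra ℂ G) (MonoidAlgebra ℂ G) | 
        IsSimpleModule (MonoidAlgebra ℂ G) S} := by
      rw [IsSemisimpleModule.sSup_simples_eq_top]; trivial
    rw [sSup_eq_iSup'] at this
    generalize (1 : MonoidAlgebra ℂ G) = y at this
    induction this using Submodule.iSup_induction' with
    | mem i x hx => exact key i.1 i.2 x hx
    | zero => simp
    | add x y _ _ hx hy => rw [mul_add, hx, hy, add_zero]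
  funext g
  rw [mul_one] at hz0
  have := congrArg (fun a : MonoidAlgebra ℂ G => a.coeff g⁻¹) hz0
  simpa [hz, Finsupp.single_apply] using this

theorem frobenius_formula
    (G : Type) [Group G] [Fintype G]
    (ι : Type) [Fintype ι] (Irr : ι → FDRep ℂ G)
    (hsimple : ∀ i, Simple (Irr i))
    (hirredundant : ∀ i j : ι, Nonempty (Irr i ≅ Irr j) → i = j)
    (hcomplete : ∀ V : FDRep ℂ G, Simple V → ∃ i, Nonempty (V ≅ Irr i))
    (w : G) :
    ((Nat.card {p : G × G // p.1 * p.2 * p.1⁻¹ * p.2⁻¹ = w} : ℕ) : ℂ)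
      = ∑ i : ι, ((Fintype.card G : ℂ) / (Irr i).character 1) * (Irr i).character w := by
  classical
  have hG : (Fintype.card G : ℂ) ≠ 0 := by simp
  have horth : ∀ i j, ∑ g, (Irr i).character g * (Irr j).character g⁻¹ =
      if i = j then (Fintype.card G : ℂ) else 0 := by
    intro i j
    have := invertibleOfNonzero (NeZero.ne (Nat.card G : ℂ))
    have h := FDRep.char_orthonormal (Irr i) (Irr j)
    have e : Nonempty (Irr i ≅ Irr j) ↔ i = j :=
      ⟨hirredundant i j, fun h => h ▸ ⟨Iso.refl _⟩⟩
    simp only [e, Nat.card_eq_fintype_card] at h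
    rw [inv_mul_eq_iff_eq_mul₀ hG] at h
    rw [h]; split_ifs <;> simp
  have hreg : ∀ g : G, ∑ i, (Irr i).character 1 * (Irr i).character g =
      if g = 1 then (Fintype.card G : ℂ) else 0 := by
    have := frob_zero (fun g : G => ∑ i, (Irr i).character 1 * (Irr i).character g -
      if g = 1 then (Fintype.card G : ℂ) else 0) (fun V hV => by
        have h := frob_class V (fun g : G => ∑ i, (Irr i).character 1 * (Irr i).character g -
          if g = 1 then (Fintype.card G : ℂ) else 0) (fun g h => by simp)
        obtain ⟨j, ⟨e⟩⟩ := hcomplete V hV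
        have h0 : ∑ g, (∑ i, (Irr i).character 1 * (Irr i).character g -
          if g = 1 then (Fintype.card G : ℂ) else 0) * V.character g⁻¹ = 0 := by
          rw [FDRep.char_iso e]
          simp_rw [sub_mul, Finset.sum_sub_distrib, Finset.sum_mul]
          rw [Finset.sum_comm]
          simp_rw [mul_assoc, ← Finset.mul_sum, horth]
          simp [mul_comm]
        rw [h0, zero_smul] at h
        exact (smul_eq_zero.1 h).resolve_left (frob_dim_ne V))
    intro g
    exact sub_eq_zero.1 (congrFun this g)
  have hcount : ∀ w : G, ((Nat.card {p : G × G // p.1 * p.2 * p.1⁻¹ * p.2⁻¹ = w} : ℕ) : ℂ)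
      = ∑ i : ι, ((Fintype.card G : ℂ) / (Irr i).character 1) * (Irr i).character w⁻¹ := by
    intro w
    apply mul_left_cancel₀ hG
    have h1 : ∑ i, (Irr i).character 1 *
        ∑ s, ∑ t, (Irr i).character (s * t * s⁻¹ * t⁻¹ * w⁻¹) =
        ∑ p : G × G, if p.1 * p.2 * p.1⁻¹ * p.2⁻¹ = w then (Fintype.card G : ℂ) else 0 := by
      simp_rw [← Fintype.sum_prod_type', Finset.mul_sum]
      rw [Finset.sum_comm]
      refine Finset.sum_congr rfl fun p _ => ?_
      rw [hreg]
      simp only [mul_inv_eq_one]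
    rw [Nat.card_eq_fintype_card, Fintype.card_subtype]
    rw [← Finset.sum_filter, Finset.sum_const, nsmul_eq_mul] at h1
    rw [mul_comm, ← h1, Finset.mul_sum]
    refine Finset.sum_congr rfl fun i _ => ?_
    rw [frob_sum]
    ring
  rw [← inv_inv w, ← hcount w⁻¹]
  congr 1
  refine Nat.card_congr ((Equiv.prodComm G G).subtypeEquiv fun p => ?_)
  simp only [Equiv.prodComm_apply, Prod.fst_swap, Prod.snd_swap]
  rw [inv_inv, ← inv_inj]
  simp [mul_assoc]
end
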